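/- arXiv:gr-qc/0110001 — 5 statements merged into one kernel-verified Lean document; each statement's English description precedes it below -/
import Mathlib

section
/- For every natural number m and every real number ℓ with ℓ > 1, the identity ∑_{i=0}^{m} C(m,i) · (ℓ−1+i)^{i−1} · (m+1−i)^{m−i−1} = (ℓ/(ℓ−1)) · (m+ℓ)^{m−1} holds, where C(m,i) denotes the binomial coefficient and the exponents i−1 and m−i−1 are integer exponents (so the i = 0 term involves (ℓ−1)^{−1} and the i = m term involves 1^{−1} = 1). -/
open Finset in
theorem sum_neg_one_pow_mul_choose_mul_add_pow {R : Type*} [CommRing R] {j n : ℕ} (h : j < n)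
    (x : R) : ∑ i ∈ range (n + 1), (-1) ^ (n - i) * (n.choose i : R) * (x + i) ^ j = 0 := by
  have key := congrFun (fwdDiff_iter_pow_eq_zero_of_lt (R := R) h) x
  rw [fwdDiff_iter_eq_sum_shift] at key
  simpa [zsmul_eq_mul] using key

open Finset in
/-- Abel's generalization of the binomial theorem. -/
theorem sum_choose_mul_add_zpow_mul_sub_pow (n : ℕ) {x : ℝ} (hx : 0 < x) (y : ℝ) :
    ∑ i ∈ range (n + 1), (n.choose i : ℝ) * (x + i) ^ ((i : ℤ) - 1) * (y - i) ^ (n - i)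
      = (x + y) ^ n / x := by
  induction n generalizing y with
  | zero => simp
  | succ n ih =>
    have hderiv (z : ℝ) : HasDerivAt (fun y : ℝ ↦ ∑ i ∈ range (n + 1 + 1),
        ((n + 1).choose i : ℝ) * (x + i) ^ ((i : ℤ) - 1) * (y - i) ^ (n + 1 - i)
        - (x + y) ^ (n + 1) / x) 0 z := by
      have h₁ : HasDerivAt (fun y : ℝ ↦ (x + y) ^ (n + 1) / x)
          ((n + 1) * ((x + z) ^ n / x)) z := by
        refine ((((hasDerivAt_id z).const_add x).fun_pow (n + 1)).div_const x).congr_deriv ?_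
        push_cast
        simp only [id]
        ring
      have h₂ : HasDerivAt (fun y : ℝ ↦ ∑ i ∈ range (n + 1 + 1),
          ((n + 1).choose i : ℝ) * (x + i) ^ ((i : ℤ) - 1) * (y - i) ^ (n + 1 - i))
          (∑ i ∈ range (n + 1 + 1), ((n + 1).choose i : ℝ) * (x + i) ^ ((i : ℤ) - 1) *
            ((n + 1 - i : ℕ) * (z - i) ^ (n - i))) z := by
        refine HasDerivAt.fun_sum fun i _ ↦ HasDerivAt.const_mul _ ?_
        refine (((hasDerivAt_id z).sub_const (i : ℝ)).fun_pow (n + 1 - i)).congr_deriv ?_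
        simp [show n + 1 - i - 1 = n - i by omega]
      refine (h₂.sub h₁).congr_deriv ?_
      rw [← ih z, sum_range_succ, mul_sum, sub_eq_zero]
      simp only [Nat.sub_self, Nat.cast_zero, zero_mul, mul_zero, add_zero]
      refine sum_congr rfl fun i _ ↦ ?_
      have hchoose : ((n + 1).choose i : ℝ) * (n + 1 - i : ℕ) = (n + 1) * n.choose i := by
        exact_mod_cast (Nat.choose_mul_succ_eq n i).symm.trans (mul_comm _ _)
      linear_combination (x + i) ^ ((i : ℤ) - 1) * (z - i) ^ (n - i) * hchoose
    have hzero : ∑ i ∈ range (n + 1 + 1), ((n + 1).choose i : ℝ) * (x + i) ^ ((i : ℤ) - 1) *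
        (-x - i) ^ (n + 1 - i) = 0 := by
      rw [← sum_neg_one_pow_mul_choose_mul_add_pow n.lt_succ_self x]
      refine sum_congr rfl fun i hi ↦ ?_
      have hxi : x + i ≠ 0 := by positivity
      have hi' : i ≤ n + 1 := Nat.lt_succ_iff.mp (mem_range.mp hi)
      have hpow : (x + i) ^ ((i : ℤ) - 1) * (x + i) ^ (n + 1 - i) = (x + i) ^ n := by
        rw [← zpow_natCast, ← zpow_natCast, ← zpow_add₀ hxi]
        congr 1
        omega
      rw [show -x - (i : ℝ) = -1 * (x + i) by ring, mul_pow, ← hpow]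
      ring
    have hconst := is_const_of_deriv_eq_zero (fun z ↦ (hderiv z).differentiableAt)
      (fun z ↦ (hderiv z).deriv) y (-x)
    simp only [hzero] at hconst
    simpa [sub_eq_zero] using hconst

open Finset in
/-- The symmetric form of Abel's generalization of the binomial theorem. -/
theorem sum_choose_mul_add_zpow_mul_add_zpow (m : ℕ) {x y : ℝ} (hx : 0 < x) (hy : 0 < y) :
    ∑ i ∈ range (m + 1), (m.choose i : ℝ) * (x + i) ^ ((i : ℤ) - 1) *
        (y + m - i) ^ ((m : ℤ) - i - 1)
      = (1 / x + 1 / y) * (x + y + m) ^ ((m : ℤ) - 1) := by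
  rcases m with _ | n
  · have : x + y ≠ 0 := by positivity
    simp
    field_simp
    ring
  have hsplit : y * ∑ i ∈ range (n + 1 + 1), ((n + 1).choose i : ℝ) * (x + i) ^ ((i : ℤ) - 1) *
        (y + (n + 1 : ℕ) - i) ^ (((n + 1 : ℕ) : ℤ) - i - 1)
      = ∑ i ∈ range (n + 1 + 1), ((n + 1).choose i : ℝ) * (x + i) ^ ((i : ℤ) - 1) *
          (y + (n + 1 : ℕ) - i) ^ (n + 1 - i)
        - (n + 1) * ∑ i ∈ range (n + 1), (n.choose i : ℝ) * (x + i) ^ ((i : ℤ) - 1) *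
          (y + (n + 1 : ℕ) - i) ^ (n - i) := by
    rw [sum_range_succ, sum_range_succ _ (n + 1), mul_add, mul_sum, mul_sum,
      add_sub_right_comm (∑ i ∈ range (n + 1), _),
      ← sum_sub_distrib]
    congr 1
    · refine sum_congr rfl fun i hi ↦ ?_
      have hi' : i ≤ n := Nat.lt_succ_iff.mp (mem_range.mp hi)
      have hchoose : ((n + 1).choose i : ℝ) * (n + 1 - i) = (n + 1) * n.choose i := by
        have := (Nat.choose_mul_succ_eq n i).symm.trans (mul_comm _ _)
        rw [← Nat.cast_inj (R := ℝ)] at this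
        push_cast [Nat.cast_sub (show i ≤ n + 1 by omega)] at this
        exact this
      rw [show ((n + 1 : ℕ) : ℤ) - i - 1 = (n - i : ℕ) by omega, zpow_natCast,
        show n + 1 - i = n - i + 1 by omega, pow_succ]
      push_cast
      linear_combination
        -(x + i) ^ ((i : ℤ) - 1) * (y + (n + 1) - i) ^ (n - i) * hchoose
    · simp
      field_simp
  rw [sum_choose_mul_add_zpow_mul_sub_pow _ hx, sum_choose_mul_add_zpow_mul_sub_pow _ hx] at hsplit
  rw [show ((n + 1 : ℕ) : ℤ) - 1 = (n : ℕ) by omega, zpow_natCast]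
  refine mul_left_cancel₀ hy.ne' (hsplit.trans ?_)
  push_cast
  field_simp
  ring


/-- The combinatorial identity (a consequence of Abel's generalization of the
binomial theorem) required in the proof of the theorem on linear delay equations:
for every natural number `m` and real `ℓ > 1`,
`∑_{i=0}^{m} C(m,i) (ℓ-1+i)^{i-1} (m+1-i)^{m-i-1} = (ℓ/(ℓ-1)) (m+ℓ)^{m-1}`,
where the exponents are integer exponents. -/
theorem abel_combinatorial_identity (m : ℕ) (ℓ : ℝ) (hℓ : ℓ > 1) :
    ∑ i ∈ Finset.range (m + 1),
      (m.choose i : ℝ) * (ℓ - 1 + (i : ℝ)) ^ ((i : ℤ) - 1) *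
        ((m : ℝ) + 1 - (i : ℝ)) ^ ((m : ℤ) - (i : ℤ) - 1)
      = ℓ / (ℓ - 1) * ((m : ℝ) + ℓ) ^ ((m : ℤ) - 1) := by
  have hpos : 0 < ℓ - 1 := sub_pos.mpr hℓ
  convert sum_choose_mul_add_zpow_mul_add_zpow m hpos one_pos using 2
  · simp only [add_comm (m : ℝ) 1]
  · field_simp
    ring
  · congr 1
    ring
end

section
/- Let E be a real Banach space, let A be a continuous linear endomorphism of E, and let τ be a real number with e·|τ|·‖A‖ < 1 (where ‖A‖ is the operator norm and e is Euler's number). Then the family of continuous linear endomorphisms j ↦ (−1)^j · ((1+j)^j/(1+j)!) · τ^j · A^{j+1}, indexed by j ∈ ℕ, is summable in operator norm (the series ∑_{j=0}^∞ (−1)^j ((1+j)^j/(1+j)!) τ^j A^{j+1} converges absolutely). -/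
/-- The coefficient bound `(1 + j) ^ j / (1 + j)! ≤ e ^ (j + 1)`. -/
theorem one_add_pow_div_factorial_le_exp_one_pow (j : ℕ) :
    (1 + j : ℝ) ^ j / ((1 + j).factorial : ℝ) ≤ Real.exp 1 ^ (j + 1) := by
  calc (1 + j : ℝ) ^ j / ((1 + j).factorial : ℝ)
      ≤ (1 + j : ℝ) ^ (1 + j) / ((1 + j).factorial : ℝ) := by
        gcongr
        · simp
        · lia
    _ ≤ Real.exp (1 + j) := Real.pow_div_factorial_le_exp _ (by positivity) _
    _ = Real.exp 1 ^ (j + 1) := by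
        rw [← Real.exp_nat_mul]
        push_cast
        ring_nf

/-- For a continuous linear endomorphism `A` of a real Banach space `E` and `τ : ℝ`
with `e·|τ|·‖A‖ < 1`, the series `∑_{j=0}^∞ (-1)^j ((1+j)^j/(1+j)!) τ^j A^{j+1}`
converges absolutely in the operator norm. -/
theorem inertial_series_summable {E : Type*} [NormedAddCommGroup E] [NormedSpace ℝ E]
    [CompleteSpace E] (A : E →L[ℝ] E) (τ : ℝ)
    (h : Real.exp 1 * |τ| * ‖A‖ < 1) :
    Summable (fun j : ℕ =>
      ‖((-1 : ℝ) ^ j * ((1 + j : ℝ) ^ j / ((1 + j).factorial : ℝ)) * τ ^ j) •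
        (A ^ (j + 1))‖) := by
  have hgeom : Summable fun j : ℕ =>
      Real.exp 1 * ‖A‖ * (Real.exp 1 * |τ| * ‖A‖) ^ j :=
    (summable_geometric_of_lt_one (by positivity) h).mul_left _
  refine hgeom.of_nonneg_of_le (fun _ => norm_nonneg _) fun j => ?_
  have hc : (0 : ℝ) ≤ (1 + j : ℝ) ^ j / ((1 + j).factorial : ℝ) := by positivity
  have hnorm : ‖(-1 : ℝ) ^ j * ((1 + j : ℝ) ^ j / ((1 + j).factorial : ℝ)) * τ ^ j‖ =
      (1 + j : ℝ) ^ j / ((1 + j).factorial : ℝ) * |τ| ^ j := by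
    rw [norm_mul, norm_mul, norm_pow, norm_pow, Real.norm_of_nonneg hc]
    simp
  rw [norm_smul, hnorm]
  calc (1 + j : ℝ) ^ j / ((1 + j).factorial : ℝ) * |τ| ^ j * ‖A ^ (j + 1)‖
      ≤ Real.exp 1 ^ (j + 1) * |τ| ^ j * ‖A‖ ^ (j + 1) := by
        gcongr
        · exact one_add_pow_div_factorial_le_exp_one_pow j
        · exact norm_pow_le' A j.succ_pos
    _ = Real.exp 1 * ‖A‖ * (Real.exp 1 * |τ| * ‖A‖) ^ j := by ring
end

section
/- There exist ε₀ > 0 and C > 0 such that for every real ε with 0 < |ε| < ε₀ there exist real numbers α, β, γ satisfying the algebraic system α + 1 = ε·α·β, β = ε·(α + β²), γ − 1 = ε·β·γ, together with the bounds |α + 1| ≤ C·ε², |β + ε| ≤ C·ε², |γ − 1| ≤ C·ε². Consequently, for such α, β, γ, the affine plane {(x, y, z) ∈ ℝ³ : z = αx + βy + γ} is invariant for the system ẋ = y, ẏ = z, ε·ż = z + x − 1: every differentiable solution (x(t), y(t), z(t)) of this system whose initial condition satisfies z(0) = α·x(0) + β·y(0) + γ satisfies z(t) = α·x(t) + β·y(t)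 + γ for all t, and along such solutions x satisfies the second-order equation ẍ = α·x + β·ẋ + γ. -/
/-- The rescaled slope `w = ε β` of the slow manifold is a root of `w (1 - w)² = -ε²`. -/
lemma exists_mul_one_sub_sq_eq_neg_sq (ε : ℝ) :
    ∃ w : ℝ, -ε ^ 2 ≤ w ∧ w ≤ 0 ∧ w * (1 - w) ^ 2 = -ε ^ 2 := by
  have hle : -ε ^ 2 ≤ (0 : ℝ) := neg_nonpos.mpr (sq_nonneg ε)
  have hcont : ContinuousOn (fun w : ℝ => w * (1 - w) ^ 2) (Set.Icc (-ε ^ 2) 0) := by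
    fun_prop
  have hmem : -ε ^ 2 ∈ Set.Icc (-ε ^ 2 * (1 - -ε ^ 2) ^ 2) (0 * (1 - (0 : ℝ)) ^ 2) := by
    constructor
    · nlinarith [pow_nonneg (sq_nonneg ε) 2, pow_nonneg (sq_nonneg ε) 3]
    · linarith
  obtain ⟨w, ⟨hw₁, hw₂⟩, hw⟩ := intermediate_value_Icc hle hcont hmem
  exact ⟨w, hw₁, hw₂, hw⟩

/-- A solution of `u' = k u` that vanishes at `0` vanishes identically. -/
lemma eq_zero_of_hasDerivAt_const_mul {u : ℝ → ℝ} {k : ℝ}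
    (hu : ∀ t, HasDerivAt u (k * u t) t) (h0 : u 0 = 0) (t : ℝ) : u t = 0 := by
  have hderiv : ∀ s, HasDerivAt (fun s => u s * Real.exp (-k * s)) 0 s := by
    intro s
    have hexp : HasDerivAt (fun s => Real.exp (-k * s)) (Real.exp (-k * s) * (-k * 1)) s :=
      ((hasDerivAt_id s).const_mul (-k)).exp
    exact ((hu s).mul hexp).congr_deriv (by ring)
  have hconst := is_const_of_deriv_eq_zero (fun s => (hderiv s).differentiableAt)
    (fun s => (hderiv s).deriv) t 0
  simpa [h0, Real.exp_ne_zero] using hconst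

/-- The affine plane `z = α x + β y + γ` is invariant as soon as its coefficients satisfy
the algebraic system. -/
lemma affine_plane_invariant {ε α β γ : ℝ} (hε : ε ≠ 0) (hα : α + 1 = ε * α * β)
    (hβ : β = ε * (α + β ^ 2)) (hγ : γ - 1 = ε * β * γ) {x y z zd : ℝ → ℝ}
    (hx : ∀ t, HasDerivAt x (y t) t) (hy : ∀ t, HasDerivAt y (z t) t)
    (hz : ∀ t, HasDerivAt z (zd t) t) (hzd : ∀ t, ε * zd t = z t + x t - 1)
    (h0 : z 0 = α * x 0 + β * y 0 + γ) (t : ℝ) : z t = α * x t + β * y t + γ := by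
  have hu : ∀ s, HasDerivAt (fun s => z s - (α * x s + β * y s + γ))
      ((1 - ε * β) / ε * (z s - (α * x s + β * y s + γ))) s := by
    intro s
    refine ((hz s).sub ((((hx s).const_mul α).add ((hy s).const_mul β)).add_const γ)).congr_deriv ?_
    rw [div_mul_eq_mul_div, eq_div_iff hε]
    linear_combination hzd s + x s * hα + y s * hβ + hγ
  exact sub_eq_zero.mp (eq_zero_of_hasDerivAt_const_mul hu (sub_eq_zero.mpr h0) t)

/-- Existence of the exact slow manifold of the system `ẋ = y, ẏ = z, ε ż = z + x - 1`:
for all small `ε ≠ 0` there are `α, β, γ` solving the algebraic system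
`α + 1 = εαβ`, `β = ε(α + β²)`, `γ - 1 = εβγ`, with `α = -1 + O(ε²)`, `β = -ε + O(ε²)`,
`γ = 1 + O(ε²)`; the affine plane `z = αx + βy + γ` is invariant, and on it `x`
satisfies the second-order (Newtonian) equation `ẍ = αx + βẋ + γ`. -/
theorem slow_manifold_invariant_plane :
    ∃ ε₀ > (0 : ℝ), ∃ C > (0 : ℝ), ∀ ε : ℝ, 0 < |ε| → |ε| < ε₀ →
      ∃ α β γ : ℝ,
        (α + 1 = ε * α * β) ∧ (β = ε * (α + β ^ 2)) ∧ (γ - 1 = ε * β * γ) ∧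
        |α + 1| ≤ C * ε ^ 2 ∧ |β + ε| ≤ C * ε ^ 2 ∧ |γ - 1| ≤ C * ε ^ 2 ∧
        ∀ x y z zd : ℝ → ℝ,
          (∀ t, HasDerivAt x (y t) t) →
          (∀ t, HasDerivAt y (z t) t) →
          (∀ t, HasDerivAt z (zd t) t) →
          (∀ t, ε * zd t = z t + x t - 1) →
          z 0 = α * x 0 + β * y 0 + γ →
          (∀ t, z t = α * x t + β * y t + γ) ∧
          (∀ t, HasDerivAt y (α * x t + β * y t + γ) t) := by
  refine ⟨1, one_pos, 2, two_pos, fun ε hpos hlt => ?_⟩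
  have hε : ε ≠ 0 := abs_pos.mp hpos
  obtain ⟨w, hw₁, hw₂, hw⟩ := exists_mul_one_sub_sq_eq_neg_sq ε
  have hw1 : 0 < 1 - w := by linarith
  have hne : 1 - w ≠ 0 := hw1.ne'
  have hα : -1 / (1 - w) + 1 = ε * (-1 / (1 - w)) * (w / ε) := by
    field_simp
    ring
  have hβ : w / ε = ε * (-1 / (1 - w) + (w / ε) ^ 2) := by
    field_simp
    linear_combination hw
  have hγ : 1 / (1 - w) - 1 = ε * (w / ε) * (1 / (1 - w)) := by
    field_simp
    ring
  have hdiv : |w / (1 - w)| ≤ ε ^ 2 := by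
    rw [abs_div, abs_of_nonpos hw₂, abs_of_pos hw1, div_le_iff₀ hw1]
    nlinarith [sq_nonneg ε]
  have hα_abs : |-1 / (1 - w) + 1| ≤ ε ^ 2 := by
    have h : -1 / (1 - w) + 1 = -(w / (1 - w)) := by
      field_simp
      ring
    rwa [h, abs_neg]
  have hγ_abs : |1 / (1 - w) - 1| ≤ ε ^ 2 := by
    have h : 1 / (1 - w) - 1 = w / (1 - w) := by
      field_simp
      ring
    rwa [h]
  have hβ_sq : (w / ε) ^ 2 ≤ ε ^ 2 := by
    rw [div_pow, div_le_iff₀ (by positivity)]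
    nlinarith
  have hβ_abs : |w / ε + ε| ≤ 2 * ε ^ 2 := by
    have h : w / ε + ε = ε * ((-1 / (1 - w) + 1) + (w / ε) ^ 2) := by
      linear_combination hβ
    rw [h, abs_mul]
    have hsum : |(-1 / (1 - w) + 1) + (w / ε) ^ 2| ≤ 2 * ε ^ 2 := by
      refine (abs_add_le _ _).trans ?_
      rw [abs_of_nonneg (sq_nonneg (w / ε))]
      linarith
    exact (mul_le_of_le_one_left (abs_nonneg _) hlt.le).trans hsum
  have hle : ε ^ 2 ≤ 2 * ε ^ 2 := by linarith [sq_nonneg ε]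
  refine ⟨-1 / (1 - w), w / ε, 1 / (1 - w), hα, hβ, hγ, hα_abs.trans hle, hβ_abs,
    hγ_abs.trans hle, fun x y z zd hx hy hz hzd h0 => ?_⟩
  have hplane := affine_plane_invariant hε hα hβ hγ hx hy hz hzd h0
  exact ⟨hplane, fun t => hplane t ▸ hy t⟩
end

section
/- Let n be a natural number, let c > 0 and L ≥ 0 be real numbers with L < c, and let y : ℝ → ℝⁿ be Lipschitz continuous with Lipschitz constant L. Then for every x ∈ ℝⁿ and every t ∈ ℝ there exists a unique τ ≥ 0 such that c·τ = ‖x − y(t − τ)‖ (Euclidean norm). -/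
/-- Well-definedness of the retarded time: if the source trajectory `y : ℝ → ℝⁿ` is
Lipschitz with constant `L < c` (sub-luminal motion), then for every field point `x`
and time `t` there is a unique delay `τ ≥ 0` with `c·τ = ‖x - y(t - τ)‖`. -/
theorem retarded_time_exists_unique (n : ℕ) (c L : ℝ) (hc : 0 < c) (hL : 0 ≤ L)
    (hLc : L < c) (y : ℝ → EuclideanSpace ℝ (Fin n))
    (hy : ∀ s t : ℝ, ‖y s - y t‖ ≤ L * |s - t|) :
    ∀ (x : EuclideanSpace ℝ (Fin n)) (t : ℝ),
      ∃! τ : ℝ, 0 ≤ τ ∧ c * τ = ‖x - y (t - τ)‖ := by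
  intro x t
  have lip : ∀ a b : ℝ, |‖x - y (t - a)‖ - ‖x - y (t - b)‖| ≤ L * |a - b| := fun a b =>
    calc |‖x - y (t - a)‖ - ‖x - y (t - b)‖|
        ≤ ‖(x - y (t - a)) - (x - y (t - b))‖ := abs_norm_sub_norm_le _ _
      _ = ‖y (t - b) - y (t - a)‖ := by rw [sub_sub_sub_cancel_left]
      _ ≤ L * |(t - b) - (t - a)| := hy _ _
      _ = L * |a - b| := by rw [sub_sub_sub_cancel_left]
  have contracting : ContractingWith (Real.toNNReal (L / c))
      (fun τ : ℝ => ‖x - y (t - τ)‖ / c) := by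
    refine ⟨by rwa [Real.toNNReal_lt_one, div_lt_one hc], LipschitzWith.of_dist_le_mul ?_⟩
    intro a b
    rw [Real.coe_toNNReal _ (div_nonneg hL hc.le), Real.dist_eq, Real.dist_eq, ← sub_div,
      abs_div, abs_of_pos hc, div_mul_eq_mul_div]
    exact div_le_div_of_nonneg_right (lip a b) hc.le
  have fixed := contracting.fixedPoint_isFixedPt
  refine ⟨_, ⟨?_, ?_⟩, fun τ hτ => contracting.fixedPoint_unique ?_⟩
  · rw [← fixed.eq]
    positivity
  · rw [mul_comm]
    exact ((div_eq_iff hc.ne').mp fixed.eq).symm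
  · exact (div_eq_iff hc.ne').mpr (by rw [mul_comm, hτ.2])
end

section
/- Let a be a nonzero real number and let N ≥ 1 be a natural number. Then there exist ε₀ > 0, C > 0, and a function λ : (−ε₀, ε₀) → ℝ with λ(0) = a such that for every τ with |τ| < ε₀: (1) λ(τ) = a · ∑_{k=0}^{N} (−τ·λ(τ))^k / k! (λ(τ) is a root of the characteristic equation of the N-th order Taylor truncation of the delay equation ẋ(t) = a·x(t−τ)); and (2) |λ(τ) − ∑_{j=0}^{N−1} (−1)^j ((1+j)^j/(1+j)!) τ^j a^{1+j}| ≤ C·|τ|^N. In other words, the slow characteristic root of the N-th order truncation agrees to order N−1 in τ with the series ∑_{j=0}^{∞} (−1)^j ((1+j)^j/(1+j)!) τ^j a^{1+j} that generates the flow on the inertial manifold. -/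
open Asymptotics Filter Topology

/-- The `n`-th partial sum of the exponential series. -/
noncomputable def expPartialSum (n : ℕ) (w : ℝ) : ℝ :=
  ∑ k ∈ Finset.range n, w ^ k / (k.factorial : ℝ)

/-- The `N`-th partial sum `∑_{n=1}^{N} n^{n-1} z^n / n!` of the tree function, the inverse
of `w ↦ w e^{-w}`. -/
noncomputable def treePartialSum (N : ℕ) (z : ℝ) : ℝ :=
  ∑ j ∈ Finset.range N, (1 + j : ℝ) ^ j / ((1 + j).factorial : ℝ) * z ^ (j + 1)

lemma continuous_expPartialSum (n : ℕ) : Continuous (expPartialSum n) := by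
  unfold expPartialSum
  fun_prop

lemma expPartialSum_succ_zero (n : ℕ) : expPartialSum (n + 1) 0 = 1 := by
  simp [expPartialSum, Finset.sum_range_succ']

lemma exp_sub_expPartialSum_isBigO (n : ℕ) :
    (fun w : ℝ => Real.exp w - expPartialSum n w) =O[𝓝 0] (fun w => w ^ n) :=
  Real.exp_sub_sum_range_isBigO_pow n

lemma exp_neg_sub_inv_expPartialSum_isBigO (n : ℕ) :
    (fun w : ℝ => Real.exp (-w) - (expPartialSum (n + 1) w)⁻¹) =O[𝓝 0]
      (fun w => w ^ (n + 1)) := by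
  have hE : Tendsto (expPartialSum (n + 1)) (𝓝 0) (𝓝 1) :=
    (continuous_expPartialSum _).tendsto' _ _ (expPartialSum_succ_zero n)
  have hne : ∀ᶠ w in 𝓝 0, expPartialSum (n + 1) w ≠ 0 := hE.eventually_ne one_ne_zero
  have hexp : (fun w : ℝ => Real.exp (-w)) =O[𝓝 0] (fun _ => (1 : ℝ)) :=
    (show Continuous fun w : ℝ => Real.exp (-w) by fun_prop).continuousAt.tendsto.isBigO_one ℝ
  have hinv : (fun w => (expPartialSum (n + 1) w)⁻¹) =O[𝓝 0] (fun _ => (1 : ℝ)) :=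
    (hE.inv₀ one_ne_zero).isBigO_one ℝ
  have h := ((exp_sub_expPartialSum_isBigO (n + 1)).neg_left.mul (hexp.mul hinv))
  refine h.congr' ?_ (by simp)
  filter_upwards [hne] with w hw
  rw [Real.exp_neg]
  have := Real.exp_ne_zero w
  field_simp
  ring

/-- The coefficient of `w^(m+1)` in the formal series `∑ n^{n-1} (w e^{-w})^n / n!`. -/
lemma sum_tree_coeff_mul_exp_coeff (m : ℕ) :
    ∑ j ∈ Finset.range (m + 1), (1 + j : ℝ) ^ j / ((1 + j).factorial : ℝ) *
      ((-(1 + j : ℝ)) ^ (m - j) / ((m - j).factorial : ℝ)) = if m = 0 then 1 else 0 := by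
  rcases Nat.eq_zero_or_pos m with rfl | hm
  · simp
  rw [if_neg hm.ne']
  have hdiff := congrFun (fwdDiff_iter_pow_eq_zero_of_lt (R := ℝ) m.lt_succ_self) 0
  rw [fwdDiff_iter_eq_sum_shift, Finset.sum_range_succ'] at hdiff
  simp only [nsmul_eq_mul, mul_one, zero_add, zsmul_eq_mul, Nat.cast_zero,
    zero_pow hm.ne', mul_zero, add_zero, Pi.zero_apply, Nat.succ_eq_add_one] at hdiff
  rw [← mul_right_inj' (Nat.cast_ne_zero.mpr (m + 1).factorial_ne_zero : ((m + 1).factorial : ℝ) ≠ 0),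
    mul_zero, ← hdiff, Finset.mul_sum]
  refine Finset.sum_congr rfl fun j hj => ?_
  have hj : j ≤ m := Nat.lt_succ_iff.mp (Finset.mem_range.mp hj)
  have hchoose : ((m + 1).choose (j + 1) : ℝ) =
      (m + 1).factorial / ((j + 1).factorial * (m - j).factorial) := by
    rw [Nat.cast_choose ℝ (by omega), Nat.add_sub_add_right]
  have hpow : (1 + j : ℝ) ^ m = (1 + j) ^ j * (1 + j) ^ (m - j) := by
    rw [← pow_add, Nat.add_sub_cancel' hj]
  push_cast
  rw [hchoose, neg_pow, add_comm (j : ℝ) 1, hpow, add_comm 1 j]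
  field_simp

lemma treePartialSum_mul_exp_neg_sub_isBigO {N : ℕ} (hN : 1 ≤ N) :
    (fun w : ℝ => treePartialSum N (w * Real.exp (-w)) - w) =O[𝓝 0]
      (fun w => w ^ (N + 1)) := by
  have hterm : ∀ j ∈ Finset.range N, (fun w : ℝ =>
      (1 + j : ℝ) ^ j / ((1 + j).factorial : ℝ) * w ^ (j + 1) *
        (Real.exp (-(1 + j : ℝ) * w) - expPartialSum (N - j) (-(1 + j : ℝ) * w)))
      =O[𝓝 0] (fun w => w ^ (N + 1)) := by
    intro j hj
    have hj : j < N := Finset.mem_range.mp hj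
    have htend : Tendsto (fun w : ℝ => -(1 + j : ℝ) * w) (𝓝 0) (𝓝 0) :=
      (continuous_const_mul _).tendsto' _ _ (mul_zero _)
    have hexp := (exp_sub_expPartialSum_isBigO (N - j)).comp_tendsto htend
    have hscale : (fun w : ℝ => (-(1 + j : ℝ) * w) ^ (N - j)) =O[𝓝 0]
        (fun w => w ^ (N - j)) := ((isBigO_refl (fun w : ℝ => w) (𝓝 0)).const_mul_left _).pow _
    refine (((isBigO_refl (fun w : ℝ => w ^ (j + 1)) (𝓝 0)).const_mul_left _).mul
      (hexp.trans hscale)).congr_right fun w => ?_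
    rw [← pow_add]
    congr 1
    omega
  refine (IsBigO.fun_sum hterm).congr_left fun w => ?_
  have hpoly : ∑ j ∈ Finset.range N, (1 + j : ℝ) ^ j / ((1 + j).factorial : ℝ) * w ^ (j + 1) *
      expPartialSum (N - j) (-(1 + j : ℝ) * w) = w := by
    calc
      _ = ∑ j ∈ Finset.range N, ∑ k ∈ Finset.range (N - j),
            (1 + j : ℝ) ^ j / ((1 + j).factorial : ℝ) *
              ((-(1 + j : ℝ)) ^ k / (k.factorial : ℝ)) * w ^ (j + k + 1) := by
        refine Finset.sum_congr rfl fun j _ => ?_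
        rw [expPartialSum, Finset.mul_sum]
        refine Finset.sum_congr rfl fun k _ => ?_
        rw [mul_pow]
        ring
      _ = ∑ m ∈ Finset.range N, (if m = 0 then 1 else 0) * w ^ (m + 1) := by
        rw [← Finset.sum_range_diag_flip N fun j k : ℕ =>
          (1 + j : ℝ) ^ j / ((1 + j).factorial : ℝ) *
            ((-(1 + j : ℝ)) ^ k / (k.factorial : ℝ)) * w ^ (j + k + 1)]
        refine Finset.sum_congr rfl fun m _ => ?_
        rw [← sum_tree_coeff_mul_exp_coeff, Finset.sum_mul]
        refine Finset.sum_congr rfl fun j hj => ?_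
        rw [Nat.add_sub_cancel' (Nat.lt_succ_iff.mp (Finset.mem_range.mp hj))]
      _ = w := by
        have : 0 < N := hN
        simp [this]
  simp only [mul_sub, Finset.sum_sub_distrib, hpoly, treePartialSum]
  congr 1
  refine Finset.sum_congr rfl fun j _ => ?_
  rw [mul_pow, ← Real.exp_nat_mul, mul_assoc]
  congr 3
  push_cast
  ring

lemma treePartialSum_mul_inv_expPartialSum_sub_isBigO {N : ℕ} (hN : 1 ≤ N) :
    (fun w : ℝ => treePartialSum N (w * (expPartialSum (N + 1) w)⁻¹) - w) =O[𝓝 0]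
      (fun w => w ^ (N + 1)) := by
  have hdiff : ContDiff ℝ 1 (treePartialSum N) := by
    unfold treePartialSum
    fun_prop
  have hlip := (hdiff.contDiffAt (x := (0 : ℝ)).hasStrictFDerivAt one_ne_zero).isBigO_sub
  have hleft : Tendsto (fun w => w * (expPartialSum (N + 1) w)⁻¹) (𝓝 0) (𝓝 0) := by
    have hE : Tendsto (expPartialSum (N + 1)) (𝓝 0) (𝓝 1) :=
      (continuous_expPartialSum _).tendsto' _ _ (expPartialSum_succ_zero N)
    simpa using tendsto_id.mul (hE.inv₀ one_ne_zero)
  have hright : Tendsto (fun w : ℝ => w * Real.exp (-w)) (𝓝 0) (𝓝 0) :=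
    (show Continuous fun w : ℝ => w * Real.exp (-w) by fun_prop).tendsto' _ _ (by simp)
  have hsub : (fun w => w * (expPartialSum (N + 1) w)⁻¹ - w * Real.exp (-w)) =O[𝓝 0]
      (fun w => w ^ (N + 1)) := by
    have h := (isBigO_refl (fun w : ℝ => w) (𝓝 0)).mul
      (exp_neg_sub_inv_expPartialSum_isBigO N).neg_left
    refine (h.congr (fun w => by ring) fun w => (pow_succ' w (N + 1)).symm).trans
      (isLittleO_pow_pow (Nat.lt_succ_self (N + 1))).isBigO
  have hcomp := hlip.comp_tendsto (hleft.prodMk_nhds hright)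
  exact ((hcomp.trans hsub).add (treePartialSum_mul_exp_neg_sub_isBigO hN)).congr_left
    fun w => by simp

lemma exists_fixedPoint_near {a τ δ : ℝ} {f : ℝ → ℝ} (hf : Continuous f)
    (hfδ : ∀ w, |w| < δ → |a * f w - a| ≤ 1) (hτ : |τ| * (|a| + 1) < δ) :
    ∃ x, |x| ≤ |a| + 1 ∧ x = a * f (-τ * x) := by
  have habs : ∀ x ∈ Set.Icc (a - 1) (a + 1), |x| ≤ |a| + 1 := fun x hx => by
    have h := abs_add_le (x - a) a
    have : |x - a| ≤ 1 := abs_le.mpr ⟨by linarith [hx.1], by linarith [hx.2]⟩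
    rw [sub_add_cancel] at h
    linarith
  have hmaps : Set.MapsTo (fun x => a * f (-τ * x)) (Set.Icc (a - 1) (a + 1))
      (Set.Icc (a - 1) (a + 1)) := fun x hx => by
    have hw : |-τ * x| < δ := by
      rw [abs_mul, abs_neg]
      exact (mul_le_mul_of_nonneg_left (habs x hx) (abs_nonneg τ)).trans_lt hτ
    have h := abs_le.mp (hfδ _ hw)
    exact ⟨by linarith [h.1], by linarith [h.2]⟩
  obtain ⟨x, hx, hfix⟩ := exists_mem_Icc_isFixedPt_of_mapsTo
    (by fun_prop : Continuous fun x => a * f (-τ * x)).continuousOn (by linarith) hmaps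
  exact ⟨x, habs x hx, hfix.symm⟩

lemma treePartialSum_neg_mul (N : ℕ) (τ a : ℝ) :
    treePartialSum N (-τ * a) = -τ * ∑ j ∈ Finset.range N,
      (-1 : ℝ) ^ j * ((1 + j : ℝ) ^ j / ((1 + j).factorial : ℝ)) * τ ^ j * a ^ (1 + j) := by
  rw [treePartialSum, Finset.mul_sum]
  refine Finset.sum_congr rfl fun j _ => ?_
  rw [mul_pow, neg_pow]
  ring

/-- For the scalar linear delay equation `ẋ(t) = a x(t-τ)` with `a ≠ 0` and the `N`-th
order "post-Newtonian" (Taylor) truncation, there is a branch `λ(τ)` of slow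
characteristic roots, with `λ(0) = a`, solving `λ = a ∑_{k=0}^{N} (-τλ)^k/k!`, which
agrees to order `N-1` in `τ` with the series
`∑_{j=0}^{∞} (-1)^j ((1+j)^j/(1+j)!) τ^j a^{1+j}` generating the flow on the inertial
manifold. -/
theorem slow_root_agrees_with_inertial_series (a : ℝ) (ha : a ≠ 0) (N : ℕ) (hN : 1 ≤ N) :
    ∃ ε₀ > (0 : ℝ), ∃ C > (0 : ℝ), ∃ lam : ℝ → ℝ,
      lam 0 = a ∧
      ∀ τ : ℝ, |τ| < ε₀ →
        (lam τ = a * ∑ k ∈ Finset.range (N + 1), (-τ * lam τ) ^ k / (k.factorial : ℝ)) ∧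
        |lam τ - ∑ j ∈ Finset.range N,
            (-1 : ℝ) ^ j * ((1 + j : ℝ) ^ j / ((1 + j).factorial : ℝ)) * τ ^ j * a ^ (1 + j)|
          ≤ C * |τ| ^ N := by
  obtain ⟨K, hK, hbound⟩ := (treePartialSum_mul_inv_expPartialSum_sub_isBigO hN).exists_pos
  have hE := (continuous_expPartialSum (N + 1)).tendsto' 0 1 (expPartialSum_succ_zero N)
  have hclose : ∀ᶠ w in 𝓝 (0 : ℝ), |a * expPartialSum (N + 1) w - a| < 1 := by
    have h := (hE.const_mul a).eventually (Metric.ball_mem_nhds (a * 1) one_pos)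
    simpa [Real.dist_eq] using h
  obtain ⟨δ, hδ, hδ'⟩ := Metric.eventually_nhds_iff.mp
    (hbound.bound.and (hclose.and (hE.eventually_ne one_ne_zero)))
  simp only [dist_zero_right, Real.norm_eq_abs] at hδ'
  have hM : 0 < |a| + 1 := by positivity
  have hroot : ∀ τ : ℝ, ∃ x : ℝ, |τ| < δ / (|a| + 1) →
      |x| ≤ |a| + 1 ∧ x = a * expPartialSum (N + 1) (-τ * x) := fun τ => by
    by_cases hτ : |τ| < δ / (|a| + 1)
    · obtain ⟨x, hx⟩ := exists_fixedPoint_near (continuous_expPartialSum (N + 1))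
        (fun w hw => (hδ' hw).2.1.le) ((lt_div_iff₀ hM).mp hτ)
      exact ⟨x, fun _ => hx⟩
    · exact ⟨0, fun h => absurd h hτ⟩
  choose lam hlam using hroot
  have hzero : lam 0 = a := by
    have h := (hlam 0 (by rw [abs_zero]; positivity)).2
    rwa [neg_zero, zero_mul, expPartialSum_succ_zero, mul_one] at h
  refine ⟨δ / (|a| + 1), by positivity, K * (|a| + 1) ^ (N + 1), by positivity, lam, hzero,
    fun τ hτ => ⟨(hlam τ hτ).2, ?_⟩⟩
  obtain ⟨hle, heq⟩ := hlam τ hτ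
  rcases eq_or_ne τ 0 with rfl | hτ0
  · obtain ⟨n, rfl⟩ := Nat.exists_eq_add_of_le' hN
    simp [hzero, Finset.sum_range_succ']
  have hw : |-τ * lam τ| ≤ |τ| * (|a| + 1) := by
    rw [abs_mul, abs_neg]
    exact mul_le_mul_of_nonneg_left hle (abs_nonneg τ)
  obtain ⟨hb, -, hne⟩ := hδ' (hw.trans_lt ((lt_div_iff₀ hM).mp hτ))
  have harg : -τ * lam τ * (expPartialSum (N + 1) (-τ * lam τ))⁻¹ = -τ * a := by
    rw [← div_eq_mul_inv, div_eq_iff hne, mul_assoc, ← heq]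
  rw [harg, treePartialSum_neg_mul, ← mul_sub, abs_mul, abs_neg, abs_sub_comm, abs_pow] at hb
  refine le_of_mul_le_mul_left (hb.trans ?_) (abs_pos.mpr hτ0)
  calc K * |-τ * lam τ| ^ (N + 1) ≤ K * (|τ| * (|a| + 1)) ^ (N + 1) := by gcongr
    _ = |τ| * (K * (|a| + 1) ^ (N + 1) * |τ| ^ N) := by rw [mul_pow]; ring
end
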